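/- Let f, Ω : ℝ² → ℝ be smooth functions of (x,t) such that ∂f/∂t = ∂⁵f/∂x⁵, ∂Ω/∂x = f², ∂Ω/∂t = 2f·∂⁴f/∂x⁴ − 2(∂f/∂x)(∂³f/∂x³) + (∂²f/∂x²)², and Ω is nowhere zero. Define q₁ := ∂f/∂x − f³/(2Ω) and q₂ := f/Ω. Then q₁ and q₂ satisfy the (1,1)-constrained CKP t₅-flow system: q_{1,t} = q_{1,xxxxx} + 20q_{1,x}²q_{2,x} + 30q₂q_{1,x}q_{1,xx} + 25q₁q_{2,x}q_{1,xx} + 25q₁q_{1,x}q_{2,xx} + 15q₁q₂q_{1,xxx} + 5q₁²q_{2,xxx} + 80q₁²q₂²q_{1,x} + 40q₁³q₂q_{2,x}, and q_{2,t} = q_{2,xxxxx} + 20q_{2,x}²q_{1,x} + 30q₁q_{2,x}q_{2,xx} + 25q₂q_{1,x}q_{2,xx} + 25q₂q_{2,x}q_{1,xx} + 15q₁q₂q_{2,xxx} + 5q₂²q_{1,xxx} + 80q₁²q₂²q_{2,x} + 40q₁q₂³q_{1,x}. -/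

import Mathlib

/-- A twice continuously differentiable function of two real variables has equal mixed partial
derivatives. -/
lemma hasDerivAt_deriv_of_contDiff {f : ℝ → ℝ → ℝ}
    (hf : ContDiff ℝ 2 (fun p : ℝ × ℝ => f p.1 p.2)) (x t : ℝ) :
    HasDerivAt (fun s => deriv (fun y => f y s) x)
      (deriv (fun y => deriv (fun s => f y s) t) x) t := by
  let F : ℝ × ℝ → ℝ := fun p => f p.1 p.2
  have hF : ContDiff ℝ 2 F := hf
  have hd : Differentiable ℝ F := hF.differentiable (by norm_num)
  have hd' : Differentiable ℝ (fderiv ℝ F) :=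
    (hF.fderiv_right (m := 1) (by norm_num)).differentiable (by norm_num)
  have cx (y s : ℝ) : HasDerivAt (fun y => (y, s)) ((1 : ℝ), (0 : ℝ)) y :=
    (hasDerivAt_id y).prodMk (hasDerivAt_const y s)
  have ct (y s : ℝ) : HasDerivAt (fun s => (y, s)) ((0 : ℝ), (1 : ℝ)) s :=
    (hasDerivAt_const s y).prodMk (hasDerivAt_id s)
  have ex (y s : ℝ) : deriv (fun y => f y s) y = fderiv ℝ F (y, s) (1, 0) :=
    (HasFDerivAt.comp_hasDerivAt (l := F) y (hd (y, s)).hasFDerivAt (cx y s)).deriv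
  have et (y s : ℝ) : deriv (fun s => f y s) s = fderiv ℝ F (y, s) (0, 1) :=
    (HasFDerivAt.comp_hasDerivAt (l := F) s (hd (y, s)).hasFDerivAt (ct y s)).deriv
  have hxt := (HasFDerivAt.comp_hasDerivAt (l := fderiv ℝ F) t
    (hd' (x, t)).hasFDerivAt (ct x t)).clm_apply (hasDerivAt_const t ((1 : ℝ), (0 : ℝ)))
  have htx := (HasFDerivAt.comp_hasDerivAt (l := fderiv ℝ F) x
    (hd' (x, t)).hasFDerivAt (cx x t)).clm_apply (hasDerivAt_const x ((0 : ℝ), (1 : ℝ)))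
  have hsymm : IsSymmSndFDerivAt ℝ F (x, t) :=
    hF.contDiffAt.isSymmSndFDerivAt (by simp)
  simp only [ex, et]
  refine hxt.congr_deriv ?_
  have e := htx.deriv
  simp only [map_zero, add_zero, Function.comp_apply] at e ⊢
  exact (hsymm _ _).trans e.symm

/-- A chain of functions, each the derivative of the previous one, lists iterated derivatives. -/
lemma iteratedDeriv_eq_of_hasDerivAt_succ {a : ℕ → ℝ → ℝ} {N : ℕ}
    (ha : ∀ n < N, ∀ y, HasDerivAt (a n) (a (n + 1) y) y) :
    ∀ n ≤ N, iteratedDeriv n (a 0) = a n := by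
  intro n
  induction n with
  | zero => simp
  | succ n ih =>
    intro hn
    rw [iteratedDeriv_succ, ih (by omega)]
    exact funext fun y => (ha n hn y).deriv

/-- The derivatives of `g 0 * w` up to order five, where `g n` is the `n`-th derivative of `g 0`
and `w' = -(g 0) ^ 2 * w ^ 2`. -/
noncomputable def quotientJet (g : ℕ → ℝ → ℝ) (w : ℝ → ℝ) : ℕ → ℝ → ℝ
  | 0, y =>
      g 0 y * w y
  | 1, y =>
      -g 0 y ^ 3 * w y ^ 2 + g 1 y * w y
  | 2, y =>
      2 * g 0 y ^ 5 * w y ^ 3 - 4 * g 0 y ^ 2 * g 1 y * w y ^ 2 + g 2 y * w y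
  | 3, y =>
      -6 * g 0 y ^ 7 * w y ^ 4 + 18 * g 0 y ^ 4 * g 1 y * w y ^ 3
      - 5 * g 0 y ^ 2 * g 2 y * w y ^ 2 - 8 * g 0 y * g 1 y ^ 2 * w y ^ 2 + g 3 y * w y
  | 4, y =>
      24 * g 0 y ^ 9 * w y ^ 5 - 96 * g 0 y ^ 6 * g 1 y * w y ^ 4
      + 28 * g 0 y ^ 4 * g 2 y * w y ^ 3 + 88 * g 0 y ^ 3 * g 1 y ^ 2 * w y ^ 3
      - 6 * g 0 y ^ 2 * g 3 y * w y ^ 2 - 26 * g 0 y * g 1 y * g 2 y * w y ^ 2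
      - 8 * g 1 y ^ 3 * w y ^ 2 + g 4 y * w y
  | 5, y =>
      -120 * g 0 y ^ 11 * w y ^ 6 + 600 * g 0 y ^ 8 * g 1 y * w y ^ 5
      - 180 * g 0 y ^ 6 * g 2 y * w y ^ 4 - 840 * g 0 y ^ 5 * g 1 y ^ 2 * w y ^ 4
      + 40 * g 0 y ^ 4 * g 3 y * w y ^ 3 + 340 * g 0 y ^ 3 * g 1 y * g 2 y * w y ^ 3
      + 280 * g 0 y ^ 2 * g 1 y ^ 3 * w y ^ 3 - 7 * g 0 y ^ 2 * g 4 y * w y ^ 2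
      - 38 * g 0 y * g 1 y * g 3 y * w y ^ 2 - 26 * g 0 y * g 2 y ^ 2 * w y ^ 2
      - 50 * g 1 y ^ 2 * g 2 y * w y ^ 2 + g 5 y * w y
  | _, _ => 0

/-- The derivatives of `g 1 - (g 0) ^ 3 * w / 2` up to order five, where `g n` is the `n`-th
derivative of `g 0` and `w' = -(g 0) ^ 2 * w ^ 2`. -/
noncomputable def darbouxJet (g : ℕ → ℝ → ℝ) (w : ℝ → ℝ) : ℕ → ℝ → ℝ
  | 0, y =>
      -1 / 2 * g 0 y ^ 3 * w y + g 1 y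
  | 1, y =>
      1 / 2 * g 0 y ^ 5 * w y ^ 2 - 3 / 2 * g 0 y ^ 2 * g 1 y * w y + g 2 y
  | 2, y =>
      -g 0 y ^ 7 * w y ^ 3 + 4 * g 0 y ^ 4 * g 1 y * w y ^ 2
      - 3 / 2 * g 0 y ^ 2 * g 2 y * w y - 3 * g 0 y * g 1 y ^ 2 * w y + g 3 y
  | 3, y =>
      3 * g 0 y ^ 9 * w y ^ 4 - 15 * g 0 y ^ 6 * g 1 y * w y ^ 3
      + 11 / 2 * g 0 y ^ 4 * g 2 y * w y ^ 2 + 19 * g 0 y ^ 3 * g 1 y ^ 2 * w y ^ 2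
      - 3 / 2 * g 0 y ^ 2 * g 3 y * w y - 9 * g 0 y * g 1 y * g 2 y * w y
      - 3 * g 1 y ^ 3 * w y + g 4 y
  | 4, y =>
      -12 * g 0 y ^ 11 * w y ^ 5 + 72 * g 0 y ^ 8 * g 1 y * w y ^ 4
      - 26 * g 0 y ^ 6 * g 2 y * w y ^ 3 - 128 * g 0 y ^ 5 * g 1 y ^ 2 * w y ^ 3
      + 7 * g 0 y ^ 4 * g 3 y * w y ^ 2 + 69 * g 0 y ^ 3 * g 1 y * g 2 y * w y ^ 2
      + 60 * g 0 y ^ 2 * g 1 y ^ 3 * w y ^ 2 - 3 / 2 * g 0 y ^ 2 * g 4 y * w y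
      - 12 * g 0 y * g 1 y * g 3 y * w y - 9 * g 0 y * g 2 y ^ 2 * w y
      - 18 * g 1 y ^ 2 * g 2 y * w y + g 5 y
  | 5, y =>
      60 * g 0 y ^ 13 * w y ^ 6 - 420 * g 0 y ^ 10 * g 1 y * w y ^ 5
      + 150 * g 0 y ^ 8 * g 2 y * w y ^ 4 + 960 * g 0 y ^ 7 * g 1 y ^ 2 * w y ^ 4
      - 40 * g 0 y ^ 6 * g 3 y * w y ^ 3 - 550 * g 0 y ^ 5 * g 1 y * g 2 y * w y ^ 3
      - 760 * g 0 y ^ 4 * g 1 y ^ 3 * w y ^ 3 + 17 / 2 * g 0 y ^ 4 * g 4 y * w y ^ 2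
      + 109 * g 0 y ^ 3 * g 1 y * g 3 y * w y ^ 2 + 78 * g 0 y ^ 3 * g 2 y ^ 2 * w y ^ 2
      + 405 * g 0 y ^ 2 * g 1 y ^ 2 * g 2 y * w y ^ 2 - 3 / 2 * g 0 y ^ 2 * g 5 y * w y
      + 120 * g 0 y * g 1 y ^ 4 * w y ^ 2 - 15 * g 0 y * g 1 y * g 4 y * w y
      - 30 * g 0 y * g 2 y * g 3 y * w y - 30 * g 1 y ^ 2 * g 3 y * w y
      - 45 * g 1 y * g 2 y ^ 2 * w y + g 6 y
  | _, _ => 0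

lemma hasDerivAt_quotientJet {g : ℕ → ℝ → ℝ} {w : ℝ → ℝ}
    (hg : ∀ n y, HasDerivAt (g n) (g (n + 1) y) y)
    (hw : ∀ y, HasDerivAt w (-(g 0 y ^ 2 * w y ^ 2)) y) :
    ∀ n < 5, ∀ y, HasDerivAt (quotientJet g w n) (quotientJet g w (n + 1) y) y := by
  have dg : ∀ n, Differentiable ℝ (g n) := fun n y => (hg n y).differentiableAt
  have dw : Differentiable ℝ w := fun y => (hw y).differentiableAt
  have eg : ∀ n y, deriv (g n) y = g (n + 1) y := fun n y => (hg n y).deriv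
  have ew : ∀ y, deriv w y = _ := fun y => (hw y).deriv
  intro n hn y
  interval_cases n <;>
  · unfold quotientJet
    refine DifferentiableAt.hasDerivAt (by fun_prop) |>.congr_deriv ?_
    simp (disch := fun_prop) only [deriv_fun_add, deriv_fun_sub, deriv_fun_mul,
      deriv_fun_pow, deriv.fun_neg, deriv_const, eg, ew]
    push_cast
    ring

lemma hasDerivAt_darbouxJet {g : ℕ → ℝ → ℝ} {w : ℝ → ℝ}
    (hg : ∀ n y, HasDerivAt (g n) (g (n + 1) y) y)
    (hw : ∀ y, HasDerivAt w (-(g 0 y ^ 2 * w y ^ 2)) y) :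
    ∀ n < 5, ∀ y, HasDerivAt (darbouxJet g w n) (darbouxJet g w (n + 1) y) y := by
  have dg : ∀ n, Differentiable ℝ (g n) := fun n y => (hg n y).differentiableAt
  have dw : Differentiable ℝ w := fun y => (hw y).differentiableAt
  have eg : ∀ n y, deriv (g n) y = g (n + 1) y := fun n y => (hg n y).deriv
  have ew : ∀ y, deriv w y = _ := fun y => (hw y).deriv
  intro n hn y
  interval_cases n <;>
  · unfold darbouxJet
    refine DifferentiableAt.hasDerivAt (by fun_prop) |>.congr_deriv ?_
    simp (disch := fun_prop) only [deriv_fun_add, deriv_fun_sub, deriv_fun_mul,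
      deriv_fun_pow, deriv.fun_neg, deriv_const, eg, ew]
    push_cast
    ring


/-- The M = 1 instance of Theorem 3.2 for the t₅-flow: if `f_t = f_xxxxx`,
`Ω_x = f²`, `Ω_t = 2f·f_xxxx − 2f_x·f_xxx + f_xx²`, `Ω ≠ 0`, then
`q₁ = f_x − f³/(2Ω)` and `q₂ = f/Ω` solve the (1,1)-constrained CKP t₅-flow system. -/
theorem stmt_9 (f Ω : ℝ → ℝ → ℝ)
    (hf : ContDiff ℝ (⊤ : ℕ∞) (fun p : ℝ × ℝ => f p.1 p.2))
    (hΩ : ContDiff ℝ (⊤ : ℕ∞) (fun p : ℝ × ℝ => Ω p.1 p.2))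
    (hft : ∀ x t, deriv (fun s => f x s) t = iteratedDeriv 5 (fun y => f y t) x)
    (hΩx : ∀ x t, deriv (fun y => Ω y t) x = (f x t) ^ 2)
    (hΩt : ∀ x t, deriv (fun s => Ω x s) t
      = 2 * f x t * iteratedDeriv 4 (fun y => f y t) x
        - 2 * deriv (fun y => f y t) x * iteratedDeriv 3 (fun y => f y t) x
        + (iteratedDeriv 2 (fun y => f y t) x) ^ 2)
    (hΩ0 : ∀ x t, Ω x t ≠ 0)
    (q₁ q₂ : ℝ → ℝ → ℝ)
    (hq₁ : ∀ x t, q₁ x t = deriv (fun y => f y t) x - (f x t) ^ 3 / (2 * Ω x t))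
    (hq₂ : ∀ x t, q₂ x t = f x t / Ω x t) :
    ∀ x t : ℝ,
      deriv (fun s => q₁ x s) t
        = iteratedDeriv 5 (fun y => q₁ y t) x
          + 20 * (deriv (fun y => q₁ y t) x) ^ 2 * deriv (fun y => q₂ y t) x
          + 30 * q₂ x t * deriv (fun y => q₁ y t) x * iteratedDeriv 2 (fun y => q₁ y t) x
          + 25 * q₁ x t * deriv (fun y => q₂ y t) x * iteratedDeriv 2 (fun y => q₁ y t) x
          + 25 * q₁ x t * deriv (fun y => q₁ y t) x * iteratedDeriv 2 (fun y => q₂ y t) x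
          + 15 * q₁ x t * q₂ x t * iteratedDeriv 3 (fun y => q₁ y t) x
          + 5 * (q₁ x t) ^ 2 * iteratedDeriv 3 (fun y => q₂ y t) x
          + 80 * (q₁ x t) ^ 2 * (q₂ x t) ^ 2 * deriv (fun y => q₁ y t) x
          + 40 * (q₁ x t) ^ 3 * q₂ x t * deriv (fun y => q₂ y t) x ∧
      deriv (fun s => q₂ x s) t
        = iteratedDeriv 5 (fun y => q₂ y t) x
          + 20 * (deriv (fun y => q₂ y t) x) ^ 2 * deriv (fun y => q₁ y t) x
          + 30 * q₁ x t * deriv (fun y => q₂ y t) x * iteratedDeriv 2 (fun y => q₂ y t) x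
          + 25 * q₂ x t * deriv (fun y => q₁ y t) x * iteratedDeriv 2 (fun y => q₂ y t) x
          + 25 * q₂ x t * deriv (fun y => q₂ y t) x * iteratedDeriv 2 (fun y => q₁ y t) x
          + 15 * q₁ x t * q₂ x t * iteratedDeriv 3 (fun y => q₂ y t) x
          + 5 * (q₂ x t) ^ 2 * iteratedDeriv 3 (fun y => q₁ y t) x
          + 80 * (q₁ x t) ^ 2 * (q₂ x t) ^ 2 * deriv (fun y => q₂ y t) x
          + 40 * q₁ x t * (q₂ x t) ^ 3 * deriv (fun y => q₁ y t) x := by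
  intro x t
  set g : ℕ → ℝ → ℝ := fun n => iteratedDeriv n (fun y => f y t) with hgdef
  set w : ℝ → ℝ := fun y => (Ω y t)⁻¹ with hwdef
  have hfx : ContDiff ℝ (⊤ : ℕ∞) (fun y => f y t) :=
    hf.comp (contDiff_id.prodMk contDiff_const)
  have hΩ1 : Differentiable ℝ (fun y => Ω y t) :=
    (hΩ.comp (contDiff_id.prodMk contDiff_const)).differentiable (by simp)
  have hΩ2 : Differentiable ℝ (fun s => Ω x s) :=
    (hΩ.comp (contDiff_const.prodMk contDiff_id)).differentiable (by simp)
  have hf2 : Differentiable ℝ (fun s => f x s) :=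
    (hf.comp (contDiff_const.prodMk contDiff_id)).differentiable (by simp)
  have hg0 (y : ℝ) : g 0 y = f y t := by simp [hgdef]
  have hg1 (y : ℝ) : g 1 y = deriv (fun y => f y t) y := by simp [hgdef]
  have hg (n : ℕ) (y : ℝ) : HasDerivAt (g n) (g (n + 1) y) y := by
    have hn : Differentiable ℝ (g n) :=
      hfx.differentiable_iteratedDeriv n (by exact_mod_cast WithTop.coe_lt_top n)
    simpa only [hgdef, iteratedDeriv_succ] using (hn y).hasDerivAt
  have hw (y : ℝ) : HasDerivAt w (-(g 0 y ^ 2 * w y ^ 2)) y := by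
    refine ((hΩ1 y).hasDerivAt.fun_inv (hΩ0 y t)).congr_deriv ?_
    rw [hΩx, hg0, hwdef]
    ring
  have e₁ : (fun y => q₁ y t) = darbouxJet g w 0 := by
    funext y
    rw [hq₁, darbouxJet, hg0, hg1]
    ring
  have e₂ : (fun y => q₂ y t) = quotientJet g w 0 := by
    funext y
    rw [hq₂, quotientJet, hg0]
    rfl
  have d₁ := iteratedDeriv_eq_of_hasDerivAt_succ (hasDerivAt_darbouxJet hg hw)
  have d₂ := iteratedDeriv_eq_of_hasDerivAt_succ (hasDerivAt_quotientJet hg hw)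
  have ht0 : HasDerivAt (fun s => f x s) (g 5 x) t :=
    (hf2 t).hasDerivAt.congr_deriv (hft x t)
  have ht1 : HasDerivAt (fun s => deriv (fun y => f y s) x) (g 6 x) t := by
    have hf₂ := contDiff_infty.1 hf 2
    refine (hasDerivAt_deriv_of_contDiff hf₂ x t).congr_deriv ?_
    simp only [hft]
    exact (hg 5 x).deriv
  have htw : HasDerivAt (fun s => (Ω x s)⁻¹)
      (-(2 * g 0 x * g 4 x - 2 * g 1 x * g 3 x + g 2 x ^ 2) * w x ^ 2) t := by
    refine ((hΩ2 t).hasDerivAt.fun_inv (hΩ0 x t)).congr_deriv ?_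
    rw [hΩt, hg0, hg1, hwdef]
    ring
  have hq₁t : deriv (fun s => q₁ x s) t = g 6 x - (3 * g 0 x ^ 2 * g 5 x * w x
      - g 0 x ^ 3 * (2 * g 0 x * g 4 x - 2 * g 1 x * g 3 x + g 2 x ^ 2) * w x ^ 2) / 2 := by
    have e : (fun s => q₁ x s) =
        fun s => deriv (fun y => f y s) x - f x s ^ 3 * (Ω x s)⁻¹ / 2 := by
      funext s
      rw [hq₁]
      ring
    rw [e, (ht1.fun_sub (((ht0.fun_pow 3).fun_mul htw).div_const 2)).deriv, hg0, hwdef]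
    push_cast
    ring
  have hq₂t : deriv (fun s => q₂ x s) t = g 5 x * w x
      - g 0 x * (2 * g 0 x * g 4 x - 2 * g 1 x * g 3 x + g 2 x ^ 2) * w x ^ 2 := by
    simp only [hq₂, div_eq_mul_inv]
    rw [(ht0.fun_mul htw).deriv, hg0, hwdef]
    ring
  have v₁ : q₁ x t = darbouxJet g w 0 x := congrFun e₁ x
  have v₂ : q₂ x t = quotientJet g w 0 x := congrFun e₂ x
  rw [hq₁t, hq₂t, ← iteratedDeriv_one, ← iteratedDeriv_one, e₁, e₂, v₁, v₂,
    d₁ 1 (by norm_num), d₁ 2 (by norm_num), d₁ 3 (by norm_num), d₁ 5 (by norm_num),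
    d₂ 1 (by norm_num), d₂ 2 (by norm_num), d₂ 3 (by norm_num), d₂ 5 (by norm_num)]
  clear_value g w
  simp only [darbouxJet, quotientJet]
  constructor <;> ring
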